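/- There is a universal constant C > 0 such that: for every k ∈ ℝ with |k| ≥ 1, every t ≥ 0, and all functions ψ, w : [−1,1] → ℂ with ψ three times continuously differentiable, w three times continuously differentiable, ψ(±1) = 0, w(±1) = 0, and ψ''(y) − k² ψ(y) = −w(y) on (−1,1), one has |k|⁴ ‖ψ' + i k t ψ‖_{L²} ≤ C (1+t)^{−2} ( ‖(e_{k,t} w)'''‖²_{L²} + k² ‖(e_{k,t} w)''‖²_{L²} + k⁴ ‖(e_{k,t} w)'‖²_{L²} + k⁶ ‖w‖²_{L²} )^{1/2}, where e_{k,t}(y) = e^{i k y t} and derivatives of e_{k,t} w are taken in y. -/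

import Mathlib

open Set

/-- The squared `L²` norm of a function on the interval `(-1, 1)`. -/
noncomputable def L2sq (h : ℝ → ℂ) : ℝ :=
  ∫ y in (-1 : ℝ)..1, ‖h y‖ ^ 2

/-- The function `y ↦ e^{ikyt} w(y)`. -/
noncomputable def ew (k t : ℝ) (w : ℝ → ℂ) : ℝ → ℂ :=
  fun y => Complex.exp (Complex.I * (k : ℂ) * (y : ℂ) * (t : ℂ)) * w y

lemma HasDerivAt.continuous_of_forall {u u' : ℝ → ℂ} (h : ∀ y, HasDerivAt u (u' y) y) :
    Continuous u :=
  continuous_iff_continuousAt.2 fun y => (h y).continuousAt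

lemma L2sq_nonneg (h : ℝ → ℂ) : 0 ≤ L2sq h :=
  intervalIntegral.integral_nonneg (by norm_num) fun _ _ => by positivity

lemma L2sq_congr_norm {g h : ℝ → ℂ} (H : ∀ y, ‖g y‖ = ‖h y‖) : L2sq g = L2sq h := by
  simp only [L2sq, H]

lemma L2sq_mono {g h : ℝ → ℂ} (hg : Continuous g) (hh : Continuous h)
    (H : ∀ y ∈ Icc (-1 : ℝ) 1, ‖g y‖ ≤ ‖h y‖) : L2sq g ≤ L2sq h := by
  refine intervalIntegral.integral_mono_on (by norm_num)
    ((by fun_prop : Continuous _).intervalIntegrable _ _)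
    ((by fun_prop : Continuous _).intervalIntegrable _ _) fun y hy => ?_
  have := H y hy
  gcongr

lemma L2sq_const_mul (c : ℂ) (h : ℝ → ℂ) : L2sq (fun y => c * h y) = ‖c‖ ^ 2 * L2sq h := by
  simp only [L2sq, norm_mul, mul_pow, intervalIntegral.integral_const_mul]

lemma ofReal_L2sq (h : ℝ → ℂ) : ((L2sq h : ℝ) : ℂ) = ∫ y in (-1 : ℝ)..1, h y * star (h y) := by
  rw [L2sq, ← intervalIntegral.integral_ofReal]
  refine intervalIntegral.integral_congr fun y _ => ?_
  simp [Complex.mul_conj, Complex.normSq_eq_norm_sq]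

/-- The Cauchy–Schwarz inequality on `(-1, 1)`. -/
lemma norm_integral_mul_le {g h : ℝ → ℂ} (hg : Continuous g) (hh : Continuous h) :
    ‖∫ y in (-1 : ℝ)..1, g y * h y‖ ≤ √(L2sq g) * √(L2sq h) := by
  have hI {f : ℝ → ℝ} (hf : Continuous f) :
      IntervalIntegrable f MeasureTheory.volume (-1) 1 := hf.intervalIntegrable _ _
  refine (intervalIntegral.norm_integral_le_integral_norm (by norm_num)).trans ?_
  simp only [norm_mul]
  rw [← Real.sqrt_mul (L2sq_nonneg g)]
  apply Real.le_sqrt_of_sq_le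
  have key := discrim_le_zero (a := L2sq g) (b := -2 * ∫ y in (-1 : ℝ)..1, ‖g y‖ * ‖h y‖)
    (c := L2sq h) fun x => by
      have h0 : 0 ≤ ∫ y in (-1 : ℝ)..1, (‖g y‖ * x - ‖h y‖) ^ 2 :=
        intervalIntegral.integral_nonneg (by norm_num) fun _ _ => by positivity
      refine h0.trans_eq (Eq.symm ?_)
      simp only [L2sq]
      rw [← intervalIntegral.integral_const_mul, ← intervalIntegral.integral_mul_const,
        ← intervalIntegral.integral_mul_const,
        ← intervalIntegral.integral_add (hI (by fun_prop)) (hI (by fun_prop)),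
        ← intervalIntegral.integral_add (hI (by fun_prop)) (hI (by fun_prop))]
      refine intervalIntegral.integral_congr fun y _ => ?_
      ring
  rw [discrim] at key
  nlinarith

/-- Integration by parts against the twisted derivative `u₁ = u' + iτu`. -/
lemma twisted_integral_by_parts {τ : ℝ} {u u₁ φ φ' : ℝ → ℂ}
    (hu : ∀ y, HasDerivAt u (u₁ y - Complex.I * τ * u y) y) (hφ : ∀ y, HasDerivAt φ (φ' y) y)
    (hu₁ : Continuous u₁) (hφ' : Continuous φ') :
    Complex.I * τ * ∫ y in (-1 : ℝ)..1, u y * φ y =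
      (∫ y in (-1 : ℝ)..1, u₁ y * φ y) + (∫ y in (-1 : ℝ)..1, u y * φ' y)
        - (u 1 * φ 1 - u (-1) * φ (-1)) := by
  have cu : Continuous u := HasDerivAt.continuous_of_forall hu
  have cφ : Continuous φ := HasDerivAt.continuous_of_forall hφ
  have hI {f : ℝ → ℂ} (hf : Continuous f) :
      IntervalIntegrable f MeasureTheory.volume (-1) 1 := hf.intervalIntegrable _ _
  have h := intervalIntegral.integral_mul_deriv_eq_deriv_mul (a := -1) (b := 1)
    (fun y _ => hu y) (fun y _ => hφ y) (hI (by fun_prop)) (hI hφ')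
  have h2 : ∫ y in (-1 : ℝ)..1, (u₁ y - Complex.I * τ * u y) * φ y =
      (∫ y in (-1 : ℝ)..1, u₁ y * φ y) - Complex.I * τ * ∫ y in (-1 : ℝ)..1, u y * φ y := by
    rw [← intervalIntegral.integral_const_mul,
      ← intervalIntegral.integral_sub (hI (by fun_prop)) (hI (by fun_prop))]
    refine intervalIntegral.integral_congr fun y _ => ?_
    ring
  rw [h2] at h
  rw [h]
  ring

/-- Boundary values are controlled by the `L²` norms of a function and its twisted derivative. -/
lemma boundary_norm_sq_le {τ : ℝ} {u u₁ : ℝ → ℂ}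
    (hu : ∀ y, HasDerivAt u (u₁ y - Complex.I * τ * u y) y) (hu₁ : Continuous u₁) :
    ‖u 1‖ ^ 2 + ‖u (-1)‖ ^ 2 ≤ L2sq u + 2 * (√(L2sq u) * √(L2sq u₁)) := by
  have cu : Continuous u := HasDerivAt.continuous_of_forall hu
  have hI {f : ℝ → ℂ} (hf : Continuous f) :
      IntervalIntegrable f MeasureTheory.volume (-1) 1 := hf.intervalIntegrable _ _
  have hid (y : ℝ) : HasDerivAt (fun y : ℝ => (y : ℂ)) 1 y := by
    simpa using (hasDerivAt_id y).ofReal_comp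
  have hF (y : ℝ) : HasDerivAt (fun y : ℝ => (y : ℂ) * (u y * star (u y)))
      (u y * star (u y) + ((y * u₁ y) * star (u y) + u y * (y * star (u₁ y)))) y := by
    refine ((hid y).fun_mul ((hu y).fun_mul (hu y).star)).congr_deriv ?_
    simp
    ring
  have hint := intervalIntegral.integral_eq_sub_of_hasDerivAt (a := -1) (b := 1)
    (fun y _ => hF y) (hI (by fun_prop))
  rw [intervalIntegral.integral_add (hI (by fun_prop)) (hI (by fun_prop)),
    intervalIntegral.integral_add (hI (by fun_prop)) (hI (by fun_prop)), ← ofReal_L2sq] at hint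
  have hmono : √(L2sq fun y => (y : ℂ) * u₁ y) ≤ √(L2sq u₁) := by
    refine Real.sqrt_le_sqrt (L2sq_mono (by fun_prop) hu₁ fun y hy => ?_)
    rw [norm_mul, Complex.norm_real, Real.norm_eq_abs]
    exact mul_le_of_le_one_left (norm_nonneg _) (abs_le.2 hy)
  have e1 := norm_integral_mul_le (g := fun y => (y : ℂ) * u₁ y) (h := fun y => star (u y))
    (by fun_prop) (by fun_prop)
  have e2 := norm_integral_mul_le (g := u) (h := fun y => (y : ℂ) * star (u₁ y))
    (by fun_prop) (by fun_prop)
  rw [L2sq_congr_norm (g := fun y => star (u y)) (h := u) (by simp)] at e1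
  rw [L2sq_congr_norm (g := fun y => (y : ℂ) * star (u₁ y)) (h := fun y => (y : ℂ) * u₁ y)
    (by simp)] at e2
  have hval : ((‖u 1‖ ^ 2 + ‖u (-1)‖ ^ 2 : ℝ) : ℂ) =
      ((1 : ℝ) : ℂ) * (u 1 * star (u 1)) - ((-1 : ℝ) : ℂ) * (u (-1) * star (u (-1))) := by
    simp [Complex.mul_conj, Complex.normSq_eq_norm_sq]
  rw [← hval] at hint
  have hn := congrArg norm hint
  rw [Complex.norm_of_nonneg (by positivity)] at hn
  rw [← hn]
  refine (norm_add_le _ _).trans ?_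
  rw [Complex.norm_of_nonneg (L2sq_nonneg u)]
  have h3 := mul_le_mul_of_nonneg_left hmono (Real.sqrt_nonneg (L2sq u))
  have h4 := norm_add_le (∫ y in (-1 : ℝ)..1, (y * u₁ y) * star (u y))
    (∫ y in (-1 : ℝ)..1, u y * (y * star (u₁ y)))
  linarith

/-- Solvability of the Dirichlet problem `χ'' - k²χ = -r` on `[-1, 1]`. -/
lemma exists_dirichlet_solution {k : ℝ} (hk : k ≠ 0) {r : ℝ → ℂ} (hr : Continuous r) :
    ∃ χ χ' : ℝ → ℂ, (∀ y, HasDerivAt χ (χ' y) y) ∧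
      (∀ y, HasDerivAt χ' ((k : ℂ) ^ 2 * χ y - r y) y) ∧ χ (-1) = 0 ∧ χ 1 = 0 := by
  have hkc : (k : ℂ) ≠ 0 := by exact_mod_cast hk
  set S : ℝ → ℝ → ℂ := fun a y => ((Real.sinh (k * (y + a)) : ℝ) : ℂ) with hS
  set K : ℝ → ℝ → ℂ := fun a y => ((Real.cosh (k * (y + a)) : ℝ) : ℂ) with hK
  have dlin (a y : ℝ) : HasDerivAt (fun y => k * (y + a)) k y := by
    simpa using ((hasDerivAt_id y).add_const a).const_mul k
  have dsh (a y : ℝ) : HasDerivAt (S a) (k * K a y) y := by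
    refine (dlin a y).sinh.ofReal_comp.congr_deriv ?_
    simp [hK, mul_comm]
  have dch (a y : ℝ) : HasDerivAt (K a) (k * S a y) y := by
    refine (dlin a y).cosh.ofReal_comp.congr_deriv ?_
    simp [hS, mul_comm]
  have cS (a) : Continuous (S a) := HasDerivAt.continuous_of_forall (dsh a)
  have cK (a) : Continuous (K a) := HasDerivAt.continuous_of_forall (dch a)
  have hKS (y : ℝ) : K 0 y ^ 2 - S 0 y ^ 2 = 1 := by
    simp only [hS, hK]
    exact_mod_cast Real.cosh_sq_sub_sinh_sq (k * (y + 0))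
  set A : ℝ → ℂ := fun y => ∫ s in (-1 : ℝ)..y, K 0 s * r s
  set B : ℝ → ℂ := fun y => ∫ s in (-1 : ℝ)..y, S 0 s * r s
  have dA (y : ℝ) : HasDerivAt A (K 0 y * r y) y :=
    (((cK 0).mul hr).integral_hasStrictDerivAt (-1) y).hasDerivAt
  have dB (y : ℝ) : HasDerivAt B (S 0 y * r y) y :=
    (((cS 0).mul hr).integral_hasStrictDerivAt (-1) y).hasDerivAt
  have hS1 : S 1 1 ≠ 0 := by
    simp only [hS]
    exact_mod_cast Real.sinh_ne_zero.2 (mul_ne_zero hk (by norm_num))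
  set c : ℂ := (k : ℂ)⁻¹ * (S 0 1 * A 1 - K 0 1 * B 1) / S 1 1 with hc
  refine ⟨fun y => c * S 1 y - (k : ℂ)⁻¹ * (S 0 y * A y - K 0 y * B y),
    fun y => c * (k * K 1 y) - (K 0 y * A y - S 0 y * B y), fun y => ?_, fun y => ?_, ?_, ?_⟩
  · refine (((dsh 1 y).const_mul c).fun_sub ((((dsh 0 y).fun_mul (dA y)).fun_sub
      ((dch 0 y).fun_mul (dB y))).const_mul (k : ℂ)⁻¹)).congr_deriv ?_
    field_simp
    ring
  · refine ((((dch 1 y).const_mul (k : ℂ)).const_mul c).fun_sub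
      (((dch 0 y).fun_mul (dA y)).fun_sub ((dsh 0 y).fun_mul (dB y)))).congr_deriv ?_
    have := hKS y
    field_simp
    linear_combination (-r y) * this
  · simp [A, B, hS]
  · simp only [hc]
    field_simp
    ring

lemma L2sq_add_le {g h : ℝ → ℂ} (hg : Continuous g) (hh : Continuous h) :
    L2sq (fun y => g y + h y) ≤ 2 * L2sq g + 2 * L2sq h := by
  have hI {f : ℝ → ℝ} (hf : Continuous f) :
      IntervalIntegrable f MeasureTheory.volume (-1) 1 := hf.intervalIntegrable _ _
  simp only [L2sq]
  rw [← intervalIntegral.integral_const_mul, ← intervalIntegral.integral_const_mul,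
    ← intervalIntegral.integral_add (hI (by fun_prop)) (hI (by fun_prop))]
  refine intervalIntegral.integral_mono_on (by norm_num) (hI (by fun_prop)) (hI (by fun_prop))
    fun y _ => ?_
  have h1 := norm_add_le (g y) (h y)
  nlinarith [sq_nonneg (‖g y‖ - ‖h y‖), norm_nonneg (g y + h y), norm_nonneg (g y),
    norm_nonneg (h y)]

lemma integral_deriv_mul_eq_neg {u u' φ φ' : ℝ → ℂ} (hu : ∀ y, HasDerivAt u (u' y) y)
    (hφ : ∀ y, HasDerivAt φ (φ' y) y) (hu' : Continuous u') (hφ' : Continuous φ')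
    (h₀ : φ (-1) = 0) (h₁ : φ 1 = 0) :
    ∫ y in (-1 : ℝ)..1, u' y * φ y = -∫ y in (-1 : ℝ)..1, u y * φ' y := by
  have h := twisted_integral_by_parts (τ := 0) (u := u) (u₁ := u') (by simpa using hu) hφ hu' hφ'
  simp only [h₀, h₁, Complex.ofReal_zero] at h
  linear_combination -h

section Dirichlet

variable {k : ℝ} {χ χ' χ₂ s : ℝ → ℂ}

/-- Weak form of `χ'' = k²χ - s`. -/
lemma integral_source_mul (hχ : ∀ y, HasDerivAt χ (χ' y) y) (hχ' : ∀ y, HasDerivAt χ' (χ₂ y) y)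
    (cχ₂ : Continuous χ₂) (cs : Continuous s)
    (eq : ∀ y ∈ Icc (-1 : ℝ) 1, χ₂ y = (k : ℂ) ^ 2 * χ y - s y) {φ φ' : ℝ → ℂ}
    (hφ : ∀ y, HasDerivAt φ (φ' y) y) (cφ' : Continuous φ') (h₀ : φ (-1) = 0) (h₁ : φ 1 = 0) :
    ∫ y in (-1 : ℝ)..1, s y * φ y =
      (∫ y in (-1 : ℝ)..1, χ' y * φ' y) + (k : ℂ) ^ 2 * ∫ y in (-1 : ℝ)..1, χ y * φ y := by
  have cχ : Continuous χ := HasDerivAt.continuous_of_forall hχ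
  have cφ : Continuous φ := HasDerivAt.continuous_of_forall hφ
  have hI {f : ℝ → ℂ} (hf : Continuous f) :
      IntervalIntegrable f MeasureTheory.volume (-1) 1 := hf.intervalIntegrable _ _
  have h := integral_deriv_mul_eq_neg hχ' hφ cχ₂ cφ' h₀ h₁
  have h2 : ∫ y in (-1 : ℝ)..1, χ₂ y * φ y =
      ((k : ℂ) ^ 2 * ∫ y in (-1 : ℝ)..1, χ y * φ y) - ∫ y in (-1 : ℝ)..1, s y * φ y := by
    rw [← intervalIntegral.integral_const_mul,
      ← intervalIntegral.integral_sub (hI (by fun_prop)) (hI (by fun_prop))]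
    refine intervalIntegral.integral_congr fun y hy => ?_
    rw [uIcc_of_le (by norm_num)] at hy
    simp only [eq y hy]
    ring
  linear_combination h2 - h

lemma energy_le (hχ : ∀ y, HasDerivAt χ (χ' y) y) (hχ' : ∀ y, HasDerivAt χ' (χ₂ y) y)
    (cχ₂ : Continuous χ₂) (cs : Continuous s)
    (eq : ∀ y ∈ Icc (-1 : ℝ) 1, χ₂ y = (k : ℂ) ^ 2 * χ y - s y)
    (h₀ : χ (-1) = 0) (h₁ : χ 1 = 0) :
    L2sq χ' + k ^ 2 * L2sq χ ≤ ‖∫ y in (-1 : ℝ)..1, s y * star (χ y)‖ := by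
  have cχ' : Continuous χ' := HasDerivAt.continuous_of_forall hχ'
  have h := integral_source_mul hχ hχ' cχ₂ cs eq (fun y => (hχ y).star) (by fun_prop)
    (by simp [h₀]) (by simp [h₁])
  rw [← ofReal_L2sq, ← ofReal_L2sq] at h
  rw [h]
  exact (le_abs_self _).trans_eq (by
    rw [← Real.norm_eq_abs, ← Complex.norm_real]
    simp)

/-- Elliptic regularity for the Dirichlet problem, with the constants' dependence on `k`. -/
lemma elliptic_bounds (hk : k ≠ 0) (hχ : ∀ y, HasDerivAt χ (χ' y) y)
    (hχ' : ∀ y, HasDerivAt χ' ((k : ℂ) ^ 2 * χ y - s y) y) (cs : Continuous s)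
    (h₀ : χ (-1) = 0) (h₁ : χ 1 = 0) :
    |k| ^ 2 * √(L2sq χ) ≤ √(L2sq s) ∧ |k| * √(L2sq χ') ≤ √(L2sq s) ∧
      √(L2sq fun y => (k : ℂ) ^ 2 * χ y - s y) ≤ 2 * √(L2sq s) := by
  have cχ : Continuous χ := HasDerivAt.continuous_of_forall hχ
  have hE := (energy_le hχ hχ' (by fun_prop) cs (fun _ _ => rfl) h₀ h₁).trans
    (norm_integral_mul_le cs (by fun_prop))
  rw [L2sq_congr_norm (g := fun y => star (χ y)) (h := χ) (by simp)] at hE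
  have a := Real.sq_sqrt (L2sq_nonneg χ)
  have a' := Real.sq_sqrt (L2sq_nonneg χ')
  have b := Real.sq_sqrt (L2sq_nonneg s)
  have hadd := L2sq_add_le (g := fun y => (k : ℂ) ^ 2 * χ y) (h := fun y => -1 * s y)
    (by fun_prop) (by fun_prop)
  rw [L2sq_const_mul, L2sq_const_mul, norm_pow, Complex.norm_real, Real.norm_eq_abs] at hadd
  simp only [neg_one_mul, ← sub_eq_add_neg, norm_neg, norm_one, one_pow, one_mul] at hadd
  have hx := Real.sqrt_nonneg (L2sq χ)
  have hx' := Real.sqrt_nonneg (L2sq χ')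
  have hs := Real.sqrt_nonneg (L2sq s)
  rw [← sq_abs k, ← a, ← a', Real.sqrt_sq hx] at hE
  rw [← a, ← b] at hadd
  have hm : 0 < |k| := abs_pos.2 hk
  generalize √(L2sq χ) = x at *
  generalize √(L2sq χ') = x' at *
  generalize √(L2sq s) = σ at *
  generalize |k| = m at *
  have c0 : m ^ 2 * x ≤ σ := by
    by_contra! hlt
    have hx0 : 0 < x := by
      rcases hx.eq_or_lt with rfl | h
      · simp at hlt
        linarith
      · exact h
    nlinarith [mul_lt_mul_of_pos_right hlt hx0, sq_nonneg x']
  refine ⟨c0, ?_, ?_⟩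
  · refine le_of_sq_le_sq ?_ hs
    nlinarith [mul_le_mul_of_nonneg_left c0 hs, mul_le_mul_of_nonneg_left hE (sq_nonneg m),
      sq_nonneg (m ^ 2 * x)]
  · refine Real.sqrt_le_iff.2 ⟨by positivity, hadd.trans ?_⟩
    nlinarith [mul_le_mul c0 c0 (by positivity) hs]

end Dirichlet

lemma integral_twisted_source_mul {τ : ℝ} {w₁ w₂ φ φ' : ℝ → ℂ}
    (hw₁ : ∀ y, HasDerivAt w₁ (w₂ y - Complex.I * τ * w₁ y) y) (cw₂ : Continuous w₂)
    (hφ : ∀ y, HasDerivAt φ (φ' y) y) (cφ' : Continuous φ') (h₀ : φ (-1) = 0) (h₁ : φ 1 = 0) :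
    ∫ y in (-1 : ℝ)..1, (w₂ y - 2 * Complex.I * τ * w₁ y) * φ y =
      -(∫ y in (-1 : ℝ)..1, w₂ y * φ y) - 2 * ∫ y in (-1 : ℝ)..1, w₁ y * φ' y := by
  have cw₁ : Continuous w₁ := HasDerivAt.continuous_of_forall hw₁
  have cφ : Continuous φ := HasDerivAt.continuous_of_forall hφ
  have hI {f : ℝ → ℂ} (hf : Continuous f) :
      IntervalIntegrable f MeasureTheory.volume (-1) 1 := hf.intervalIntegrable _ _
  have h := twisted_integral_by_parts hw₁ hφ cw₂ cφ'
  have h2 : ∫ y in (-1 : ℝ)..1, (w₂ y - 2 * Complex.I * τ * w₁ y) * φ y =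
      (∫ y in (-1 : ℝ)..1, w₂ y * φ y)
        - 2 * Complex.I * τ * ∫ y in (-1 : ℝ)..1, w₁ y * φ y := by
    rw [← intervalIntegral.integral_const_mul,
      ← intervalIntegral.integral_sub (hI (by fun_prop)) (hI (by fun_prop))]
    refine intervalIntegral.integral_congr fun y _ => ?_
    ring
  rw [h2]
  rw [h₀, h₁] at h
  linear_combination -2 * h

section Remainder

variable {k t c M : ℝ} {R R' R₂ w₁ w₂ w₃ : ℝ → ℂ}

/-- Energy estimate for `R'' - k²R = -c(w₂ - 2iktw₁)`. -/
lemma remainder_energy_le (hk : k ≠ 0) (hc : 0 ≤ c)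
    (hw₁ : ∀ y, HasDerivAt w₁ (w₂ y - Complex.I * (k * t : ℝ) * w₁ y) y) (cw₂ : Continuous w₂)
    (hR : ∀ y, HasDerivAt R (R' y) y) (hR' : ∀ y, HasDerivAt R' (R₂ y) y) (cR₂ : Continuous R₂)
    (eq : ∀ y ∈ Icc (-1 : ℝ) 1, R₂ y =
      (k : ℂ) ^ 2 * R y - c * (w₂ y - 2 * Complex.I * (k * t : ℝ) * w₁ y))
    (h₀ : R (-1) = 0) (h₁ : R 1 = 0)
    (hM₁ : |k| ^ 2 * √(L2sq w₁) ≤ M) (hM₂ : |k| * √(L2sq w₂) ≤ M) :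
    |k| ^ 2 * √(L2sq R') ≤ 3 * c * M := by
  have cw₁ := HasDerivAt.continuous_of_forall hw₁
  have cR := HasDerivAt.continuous_of_forall hR
  have cR' := HasDerivAt.continuous_of_forall hR'
  have hE := energy_le hR hR' cR₂ (by fun_prop) eq h₀ h₁
  simp only [mul_assoc (c : ℂ)] at hE
  rw [intervalIntegral.integral_const_mul, norm_mul, Complex.norm_of_nonneg hc,
    integral_twisted_source_mul hw₁ cw₂ (fun y => (hR y).star) (by fun_prop) (by simp [h₀])
      (by simp [h₁])] at hE
  have e1 := norm_integral_mul_le cw₂ (h := fun y => star (R y)) (by fun_prop)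
  have e2 := norm_integral_mul_le cw₁ (h := fun y => star (R' y)) (by fun_prop)
  rw [L2sq_congr_norm (g := fun y => star (R y)) (h := R) (by simp)] at e1
  rw [L2sq_congr_norm (g := fun y => star (R' y)) (h := R') (by simp)] at e2
  have hn := norm_sub_le (-∫ y in (-1 : ℝ)..1, w₂ y * star (R y))
    (2 * ∫ y in (-1 : ℝ)..1, w₁ y * star (R' y))
  rw [norm_neg, norm_mul, Complex.norm_ofNat] at hn
  have hE2 := hE.trans (mul_le_mul_of_nonneg_left (hn.trans (add_le_add e1
    (mul_le_mul_of_nonneg_left e2 zero_le_two))) hc)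
  rw [← Real.sq_sqrt (L2sq_nonneg R), ← Real.sq_sqrt (L2sq_nonneg R'), ← sq_abs k] at hE2
  simp only [Real.sqrt_sq (Real.sqrt_nonneg _)] at hE2
  have hx := Real.sqrt_nonneg (L2sq R)
  have hx' := Real.sqrt_nonneg (L2sq R')
  have hm : 0 < |k| := abs_pos.2 hk
  have hA := Real.sqrt_nonneg (L2sq w₂)
  clear hE hn e1 e2 eq hw₁ hR hR'
  generalize √(L2sq R) = x at *
  generalize √(L2sq R') = x' at *
  generalize √(L2sq w₁) = a₁ at *
  generalize √(L2sq w₂) = a₂ at *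
  generalize |k| = m at *
  have hM0 : 0 ≤ M := le_trans (by positivity) hM₂
  have b0 : m ^ 2 * (x' ^ 2 + m ^ 2 * x ^ 2) ≤ c * (M * (m * x) + 2 * M * x') := by
    have p1 := mul_le_mul_of_nonneg_right hM₂ (by positivity : 0 ≤ m * x)
    have p2 := mul_le_mul_of_nonneg_right hM₁ hx'
    calc _ ≤ m ^ 2 * (c * (a₂ * x + 2 * (a₁ * x'))) := by gcongr
      _ = c * ((m * a₂) * (m * x) + 2 * ((m ^ 2 * a₁) * x')) := by ring
      _ ≤ c * (M * (m * x) + 2 * (M * x')) := by gcongr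
      _ = _ := by ring
  set e := √(x' ^ 2 + m ^ 2 * x ^ 2) with he
  have he2 : e ^ 2 = x' ^ 2 + m ^ 2 * x ^ 2 := Real.sq_sqrt (by positivity)
  have i1 : x' ≤ e := Real.le_sqrt_of_sq_le (by nlinarith [sq_nonneg (m * x)])
  have i2 : m * x ≤ e := Real.le_sqrt_of_sq_le (by nlinarith [sq_nonneg x'])
  rcases (Real.sqrt_nonneg _ : 0 ≤ e).eq_or_lt with h | h
  · have : x' = 0 := le_antisymm (h ▸ i1) hx'
    rw [this]
    simp only [mul_zero]
    positivity
  · have : (m ^ 2 * e) * e ≤ (3 * c * M) * e := by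
      calc (m ^ 2 * e) * e = m ^ 2 * (x' ^ 2 + m ^ 2 * x ^ 2) := by rw [← he2]; ring
        _ ≤ c * (M * (m * x) + 2 * M * x') := b0
        _ ≤ c * (M * e + 2 * M * e) := by gcongr
        _ = _ := by ring
    exact (mul_le_mul_of_nonneg_left i1 (by positivity)).trans (le_of_mul_le_mul_right this h)

/-- Duality estimate for `R'' - k²R = -c(w₂ - 2iktw₁)`, gaining a factor of `t`. -/
lemma remainder_duality_le (hk : 1 ≤ |k|) (ht : 0 ≤ t) (hc : 0 ≤ c)
    (hw₁ : ∀ y, HasDerivAt w₁ (w₂ y - Complex.I * (k * t : ℝ) * w₁ y) y)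
    (hw₂ : ∀ y, HasDerivAt w₂ (w₃ y - Complex.I * (k * t : ℝ) * w₂ y) y) (cw₃ : Continuous w₃)
    (hR : ∀ y, HasDerivAt R (R' y) y) (hR' : ∀ y, HasDerivAt R' (R₂ y) y) (cR₂ : Continuous R₂)
    (eq : ∀ y ∈ Icc (-1 : ℝ) 1, R₂ y =
      (k : ℂ) ^ 2 * R y - c * (w₂ y - 2 * Complex.I * (k * t : ℝ) * w₁ y))
    (h₀ : R (-1) = 0) (h₁ : R 1 = 0) (hM₁ : |k| ^ 2 * √(L2sq w₁) ≤ M)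
    (hM₂ : |k| * √(L2sq w₂) ≤ M) (hM₃ : √(L2sq w₃) ≤ M) :
    |k| ^ 2 * (|k| * t * √(L2sq R)) ≤ 16 * c * M := by
  have cw₁ := HasDerivAt.continuous_of_forall hw₁
  have cw₂ := HasDerivAt.continuous_of_forall hw₂
  have cR := HasDerivAt.continuous_of_forall hR
  have cR' := HasDerivAt.continuous_of_forall hR'
  have hm : 0 < |k| := by linarith
  have hk0 : k ≠ 0 := abs_pos.1 hm
  obtain ⟨χ, χ', hχ, hχ', z₀, z₁⟩ := exists_dirichlet_solution hk0 (r := fun y => star (R y))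
    (by fun_prop)
  have cχ := HasDerivAt.continuous_of_forall hχ
  have cχ' := HasDerivAt.continuous_of_forall hχ'
  obtain ⟨b0, b1, b2⟩ := elliptic_bounds hk0 hχ hχ' (by fun_prop) z₀ z₁
  rw [L2sq_congr_norm (g := fun y => star (R y)) (h := R) (by simp)] at b0 b1 b2
  have d1 := integral_source_mul hR hR' cR₂ (by fun_prop) eq hχ cχ' z₀ z₁
  have d2 := integral_source_mul hχ hχ' (by fun_prop) (by fun_prop) (fun _ _ => rfl) hR cR' h₀ h₁
  have d3 : ((L2sq R : ℝ) : ℂ) =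
      c * (-(∫ y in (-1 : ℝ)..1, w₂ y * χ y) - 2 * ∫ y in (-1 : ℝ)..1, w₁ y * χ' y) := by
    rw [← integral_twisted_source_mul hw₁ cw₂ hχ cχ' z₀ z₁, ofReal_L2sq,
      ← intervalIntegral.integral_const_mul]
    simp only [mul_assoc (c : ℂ)] at d1
    rw [d1]
    simp only [mul_comm (R _), mul_comm (R' _)]
    exact d2
  have f1 := twisted_integral_by_parts hw₂ hχ cw₃ cχ'
  have f2 := twisted_integral_by_parts hw₁ hχ' cw₂ (by fun_prop)
  rw [z₀, z₁] at f1
  set χ₂ : ℝ → ℂ := fun y => (k : ℂ) ^ 2 * χ y - star (R y)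
  have cχ₂ : Continuous χ₂ := by fun_prop
  have d4 : Complex.I * (k * t : ℝ) * ((L2sq R : ℝ) : ℂ) =
      c * (2 * (w₁ 1 * χ' 1 - w₁ (-1) * χ' (-1)) - ((∫ y in (-1 : ℝ)..1, w₃ y * χ y)
        + 3 * (∫ y in (-1 : ℝ)..1, w₂ y * χ' y) + 2 * ∫ y in (-1 : ℝ)..1, w₁ y * χ₂ y)) := by
    rw [d3]
    linear_combination (-c : ℂ) * f1 - 2 * c * f2
  have hbd : ‖w₁ 1 * χ' 1 - w₁ (-1) * χ' (-1)‖ ≤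
      √(‖w₁ 1‖ ^ 2 + ‖w₁ (-1)‖ ^ 2) * √(‖χ' 1‖ ^ 2 + ‖χ' (-1)‖ ^ 2) := by
    refine (norm_sub_le _ _).trans ?_
    rw [← Real.sqrt_mul (by positivity), norm_mul, norm_mul]
    refine Real.le_sqrt_of_sq_le ?_
    nlinarith [sq_nonneg (‖w₁ 1‖ * ‖χ' (-1)‖ - ‖w₁ (-1)‖ * ‖χ' 1‖)]
  have t1 := boundary_norm_sq_le hw₁ cw₂
  have t2 := boundary_norm_sq_le (τ := 0) (u := χ') (u₁ := χ₂)
    (fun y => (hχ' y).congr_deriv (by simp [χ₂])) cχ₂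
  have e1 := norm_integral_mul_le cw₃ cχ
  have e2 := norm_integral_mul_le cw₂ cχ'
  have e3 := norm_integral_mul_le cw₁ cχ₂
  have hn := congrArg norm d4
  rw [norm_mul, norm_mul, Complex.norm_I, one_mul, Complex.norm_real,
    Complex.norm_of_nonneg (L2sq_nonneg R), norm_mul, norm_mul, Complex.norm_of_nonneg hc,
    Real.norm_eq_abs, Real.norm_of_nonneg ht] at hn
  have hsum : ‖2 * (w₁ 1 * χ' 1 - w₁ (-1) * χ' (-1)) - ((∫ y in (-1 : ℝ)..1, w₃ y * χ y)
        + 3 * (∫ y in (-1 : ℝ)..1, w₂ y * χ' y) + 2 * ∫ y in (-1 : ℝ)..1, w₁ y * χ₂ y)‖ ≤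
      2 * (√(‖w₁ 1‖ ^ 2 + ‖w₁ (-1)‖ ^ 2) * √(‖χ' 1‖ ^ 2 + ‖χ' (-1)‖ ^ 2)) +
        (√(L2sq w₃) * √(L2sq χ) + 3 * (√(L2sq w₂) * √(L2sq χ')) +
          2 * (√(L2sq w₁) * √(L2sq χ₂))) := by
    refine (norm_sub_le _ _).trans (add_le_add ?_ ((norm_add₃_le).trans ?_))
    · rw [norm_mul, Complex.norm_ofNat]
      gcongr
    · rw [norm_mul, norm_mul, Complex.norm_ofNat, Complex.norm_ofNat]
      gcongr
  have hfin := hn.trans_le (mul_le_mul_of_nonneg_left hsum hc)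
  rw [← Real.sq_sqrt (L2sq_nonneg R)] at hfin
  rw [← Real.sq_sqrt (L2sq_nonneg w₁)] at t1
  rw [← Real.sq_sqrt (L2sq_nonneg χ')] at t2
  simp only [Real.sqrt_sq (Real.sqrt_nonneg _)] at hfin t1 t2
  have hx := Real.sqrt_nonneg (L2sq R)
  have g0 := Real.sqrt_nonneg (L2sq χ)
  have g1 := Real.sqrt_nonneg (L2sq χ')
  have g2 := Real.sqrt_nonneg (L2sq χ₂)
  have k1 := Real.sqrt_nonneg (L2sq w₁)
  have k2 := Real.sqrt_nonneg (L2sq w₂)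
  clear hn hsum e1 e2 e3 d1 d2 d3 d4 f1 f2 hbd eq hw₁ hw₂ hR hR' hχ hχ'
  have hβ₁ : 0 ≤ ‖w₁ 1‖ ^ 2 + ‖w₁ (-1)‖ ^ 2 := by positivity
  have hβ₂ : 0 ≤ ‖χ' 1‖ ^ 2 + ‖χ' (-1)‖ ^ 2 := by positivity
  generalize ‖w₁ 1‖ ^ 2 + ‖w₁ (-1)‖ ^ 2 = β₁ at *
  generalize ‖χ' 1‖ ^ 2 + ‖χ' (-1)‖ ^ 2 = β₂ at *
  generalize √(L2sq R) = ρ at *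
  generalize √(L2sq χ) = x₀ at *
  generalize √(L2sq χ') = x₁ at *
  generalize √(L2sq χ₂) = x₂ at *
  generalize √(L2sq w₁) = a₁ at *
  generalize √(L2sq w₂) = a₂ at *
  generalize √(L2sq w₃) = a₃ at *
  generalize |k| = m at *
  have hM0 : 0 ≤ M := le_trans (by positivity) hM₂
  have s1 : m ^ 3 * β₁ ≤ 3 * M ^ 2 := by
    have : m ^ 4 * β₁ ≤ m * (3 * M ^ 2) := by
      calc m ^ 4 * β₁ ≤ m ^ 4 * (a₁ ^ 2 + 2 * (a₁ * a₂)) := by gcongr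
        _ = (m ^ 2 * a₁) ^ 2 + 2 * m * ((m ^ 2 * a₁) * (m * a₂)) := by ring
        _ ≤ M ^ 2 + 2 * m * (M * M) := by gcongr
        _ ≤ m * (3 * M ^ 2) := by nlinarith [sq_nonneg M]
    refine le_of_mul_le_mul_left (le_trans (le_of_eq ?_) this) hm
    ring
  have s2 : m * β₂ ≤ 5 * ρ ^ 2 := by
    have : m ^ 2 * β₂ ≤ m * (5 * ρ ^ 2) := by
      calc m ^ 2 * β₂ ≤ m ^ 2 * (x₁ ^ 2 + 2 * (x₁ * x₂)) := by gcongr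
        _ = (m * x₁) ^ 2 + 2 * m * ((m * x₁) * x₂) := by ring
        _ ≤ ρ ^ 2 + 2 * m * (ρ * (2 * ρ)) := by gcongr
        _ ≤ m * (5 * ρ ^ 2) := by nlinarith [sq_nonneg ρ]
    refine le_of_mul_le_mul_left (le_trans (le_of_eq ?_) this) hm
    ring
  have s3 : m ^ 2 * (√β₁ * √β₂) ≤ 4 * (M * ρ) := by
    refine le_of_sq_le_sq ?_ (by positivity)
    calc (m ^ 2 * (√β₁ * √β₂)) ^ 2 = (m ^ 3 * √β₁ ^ 2) * (m * √β₂ ^ 2) := by ring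
      _ = (m ^ 3 * β₁) * (m * β₂) := by rw [Real.sq_sqrt hβ₁, Real.sq_sqrt hβ₂]
      _ ≤ (3 * M ^ 2) * (5 * ρ ^ 2) := by gcongr
      _ ≤ (4 * (M * ρ)) ^ 2 := by nlinarith [sq_nonneg (M * ρ)]
  have s4 : (m ^ 2 * (m * t * ρ)) * ρ ≤ (16 * c * M) * ρ := by
    calc (m ^ 2 * (m * t * ρ)) * ρ = m ^ 2 * (m * t * ρ ^ 2) := by ring
      _ ≤ m ^ 2 * (c * (2 * (√β₁ * √β₂) + (a₃ * x₀ + 3 * (a₂ * x₁) + 2 * (a₁ * x₂)))) := by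
        gcongr
      _ = c * (2 * (m ^ 2 * (√β₁ * √β₂)) + (a₃ * (m ^ 2 * x₀) + 3 * ((m * a₂) * (m * x₁))
            + 2 * ((m ^ 2 * a₁) * x₂))) := by ring
      _ ≤ c * (2 * (4 * (M * ρ)) + (M * ρ + 3 * (M * ρ) + 2 * (M * (2 * ρ)))) := by gcongr
      _ = _ := by ring
  rcases hx.eq_or_lt with rfl | h
  · simp only [mul_zero]
    positivity
  · exact le_of_mul_le_mul_right s4 h

end Remainder

/-- The damping estimate for the twisted derivatives `wⱼ` of `w`, up to the division by `k²`. -/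
lemma twisted_deriv_stream_le {k t M : ℝ} {ψ ψ' ψ₂ w w₁ w₂ w₃ : ℝ → ℂ} (hk : 1 ≤ |k|)
    (ht : 0 ≤ t) (hψ : ∀ y, HasDerivAt ψ (ψ' y) y) (hψ' : ∀ y, HasDerivAt ψ' (ψ₂ y) y)
    (cψ₂ : Continuous ψ₂)
    (hw : ∀ y, HasDerivAt w (w₁ y - Complex.I * (k * t : ℝ) * w y) y)
    (hw₁ : ∀ y, HasDerivAt w₁ (w₂ y - Complex.I * (k * t : ℝ) * w₁ y) y)
    (hw₂ : ∀ y, HasDerivAt w₂ (w₃ y - Complex.I * (k * t : ℝ) * w₂ y) y) (cw₃ : Continuous w₃)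
    (eq : ∀ y ∈ Icc (-1 : ℝ) 1, ψ₂ y = (k : ℂ) ^ 2 * ψ y - w y)
    (hψ₀ : ψ (-1) = 0) (hψ₁ : ψ 1 = 0) (hw₀ : w (-1) = 0) (hw1 : w 1 = 0)
    (hM₁ : |k| ^ 2 * √(L2sq w₁) ≤ M) (hM₂ : |k| * √(L2sq w₂) ≤ M) (hM₃ : √(L2sq w₃) ≤ M) :
    |k| ^ 2 * √(L2sq fun y => ψ' y + Complex.I * (k * t : ℝ) * ψ y) ≤
      24 * (k ^ 2 * (1 + t ^ 2))⁻¹ * M := by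
  have cw := HasDerivAt.continuous_of_forall hw
  have cw₁ := HasDerivAt.continuous_of_forall hw₁
  have cw₂ := HasDerivAt.continuous_of_forall hw₂
  have cψ := HasDerivAt.continuous_of_forall hψ
  have cψ' := HasDerivAt.continuous_of_forall hψ'
  have hk0 : k ≠ 0 := abs_pos.1 (by linarith)
  set c : ℝ := (k ^ 2 * (1 + t ^ 2))⁻¹ with hcdef
  have hc : 0 ≤ c := by positivity
  have hcc : (c : ℂ) * ((k : ℂ) ^ 2 * (1 + (t : ℂ) ^ 2)) = 1 := by
    have : c * (k ^ 2 * (1 + t ^ 2)) = 1 := inv_mul_cancel₀ (by positivity)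
    exact_mod_cast this
  set R : ℝ → ℂ := fun y => ψ y - c * w y
  set R' : ℝ → ℂ := fun y => ψ' y - c * (w₁ y - Complex.I * (k * t : ℝ) * w y)
  set R₂ : ℝ → ℂ := fun y => ψ₂ y - c * ((w₂ y - Complex.I * (k * t : ℝ) * w₁ y)
    - Complex.I * (k * t : ℝ) * (w₁ y - Complex.I * (k * t : ℝ) * w y))
  have hR (y : ℝ) : HasDerivAt R (R' y) y := (hψ y).fun_sub ((hw y).const_mul _)
  have hR' (y : ℝ) : HasDerivAt R' (R₂ y) y :=
    (hψ' y).fun_sub (((hw₁ y).fun_sub ((hw y).const_mul _)).const_mul _)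
  have cR := HasDerivAt.continuous_of_forall hR
  have cR' := HasDerivAt.continuous_of_forall hR'
  have cR₂ : Continuous R₂ := by fun_prop
  have eqR : ∀ y ∈ Icc (-1 : ℝ) 1, R₂ y =
      (k : ℂ) ^ 2 * R y - c * (w₂ y - 2 * Complex.I * (k * t : ℝ) * w₁ y) := fun y hy => by
    simp only [R₂, R, eq y hy, Complex.ofReal_mul]
    linear_combination (w y) * hcc - (c : ℂ) * (k * t) ^ 2 * w y * Complex.I_sq
  have z₀ : R (-1) = 0 := by simp [R, hψ₀, hw₀]
  have z₁ : R 1 = 0 := by simp [R, hψ₁, hw1]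
  have b1 := remainder_energy_le hk0 hc hw₁ cw₂ hR hR' cR₂ eqR z₀ z₁ hM₁ hM₂
  have b2 := remainder_duality_le hk ht hc hw₁ hw₂ cw₃ hR hR' cR₂ eqR z₀ z₁ hM₁ hM₂ hM₃
  have hsplit : (fun y => ψ' y + Complex.I * (k * t : ℝ) * ψ y) =
      fun y => (c * w₁ y + R' y) + Complex.I * (k * t : ℝ) * R y := by
    funext y
    simp only [R, R']
    ring
  have l1 := L2sq_add_le (g := fun y => c * w₁ y + R' y)
    (h := fun y => Complex.I * (k * t : ℝ) * R y) (by fun_prop) (by fun_prop)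
  have l2 := L2sq_add_le (g := fun y => c * w₁ y) (h := R') (by fun_prop) cR'
  rw [L2sq_const_mul, Complex.norm_of_nonneg hc] at l2
  rw [L2sq_const_mul, norm_mul, Complex.norm_I, one_mul, Complex.norm_real, norm_mul,
    Real.norm_eq_abs, Real.norm_of_nonneg ht, ← hsplit] at l1
  have hM0 : 0 ≤ M := (Real.sqrt_nonneg _).trans hM₃
  rw [← Real.sq_sqrt (L2sq_nonneg R)] at l1
  rw [← Real.sq_sqrt (L2sq_nonneg w₁), ← Real.sq_sqrt (L2sq_nonneg R')] at l2
  refine le_of_sq_le_sq ?_ (by positivity)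
  rw [mul_pow, Real.sq_sqrt (L2sq_nonneg _)]
  calc (|k| ^ 2) ^ 2 * L2sq (fun y => ψ' y + Complex.I * (k * t : ℝ) * ψ y)
      ≤ (|k| ^ 2) ^ 2 * (2 * (2 * (c ^ 2 * √(L2sq w₁) ^ 2) + 2 * √(L2sq R') ^ 2)
          + 2 * ((|k| * t) ^ 2 * √(L2sq R) ^ 2)) := by
        gcongr
        exact l1.trans (by gcongr)
    _ = 4 * (c ^ 2 * (|k| ^ 2 * √(L2sq w₁)) ^ 2) + 4 * (|k| ^ 2 * √(L2sq R')) ^ 2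
          + 2 * (|k| ^ 2 * (|k| * t * √(L2sq R))) ^ 2 := by ring
    _ ≤ 4 * (c ^ 2 * M ^ 2) + 4 * (3 * c * M) ^ 2 + 2 * (16 * c * M) ^ 2 := by gcongr
    _ ≤ (24 * c * M) ^ 2 := by nlinarith [sq_nonneg (c * M)]

lemma L2sq_ew (k t : ℝ) (w : ℝ → ℂ) : L2sq (ew k t w) = L2sq w := by
  refine L2sq_congr_norm fun y => ?_
  have : Complex.I * (k : ℂ) * (y : ℂ) * (t : ℂ) = Complex.I * ((k * y * t : ℝ) : ℂ) := by
    push_cast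
    ring
  rw [ew, norm_mul, this, Complex.norm_exp_I_mul_ofReal, one_mul]

/-- Differentiating `e^{ikyt}w` amounts to applying the twisted derivative to `w`. -/
lemma deriv_ew (k t : ℝ) {w : ℝ → ℂ} (hw : Differentiable ℝ w) :
    deriv (ew k t w) = ew k t fun y => deriv w y + Complex.I * (k * t : ℝ) * w y := by
  funext y
  have hid : HasDerivAt (fun y : ℝ => (y : ℂ)) 1 y := by
    simpa using (hasDerivAt_id y).ofReal_comp
  have h := (((hid.const_mul (Complex.I * (k : ℂ))).mul_const (t : ℂ)).cexp).fun_mul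
    (hw y).hasDerivAt
  refine (h.congr_deriv ?_).deriv
  simp only [ew, Complex.ofReal_mul]
  ring

/-- High-frequency inviscid damping estimate for `∂_y ψ + ikt ψ`:
`|k|⁴ ‖∂_y ψ + ikt ψ‖ ≤ C (1+t)^{-2} ‖(∂_y,k)³(e^{ikyt}w)‖` for `|k| ≥ 1`. -/
theorem psi1_highfreq_second :
    ∃ C > (0 : ℝ), ∀ (k t : ℝ) (ψ w : ℝ → ℂ),
      1 ≤ |k| → 0 ≤ t →
      ContDiff ℝ 3 ψ → ContDiff ℝ 3 w →
      ψ (-1) = 0 → ψ 1 = 0 → w (-1) = 0 → w 1 = 0 →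
      (∀ y ∈ Ioo (-1 : ℝ) 1, deriv (deriv ψ) y - (k : ℂ) ^ 2 * ψ y = -w y) →
      |k| ^ 4 * Real.sqrt
          (L2sq (fun y => deriv ψ y + Complex.I * (k : ℂ) * (t : ℂ) * ψ y))
        ≤ C * ((1 + t) ^ 2)⁻¹ * Real.sqrt
            (L2sq (deriv (deriv (deriv (ew k t w))))
              + k ^ 2 * L2sq (deriv (deriv (ew k t w)))
              + k ^ 4 * L2sq (deriv (ew k t w))
              + k ^ 6 * L2sq w) := by
  refine ⟨48, by norm_num, fun k t ψ w hk ht cψ cw hψ₀ hψ₁ hw₀ hw1 ode => ?_⟩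
  have hm : 0 < |k| := by linarith
  have hk0 : k ≠ 0 := abs_pos.1 hm
  have cψ1 : ContDiff ℝ 2 (deriv ψ) := ContDiff.deriv' (n := 2) (by norm_num; exact cψ)
  have cψ2 : ContDiff ℝ 1 (deriv (deriv ψ)) := ContDiff.deriv' (n := 1) (by norm_num; exact cψ1)
  have twisted {n : ℕ} {u : ℝ → ℂ} (hu : ContDiff ℝ (n + 1 : ℕ) u) :
      ContDiff ℝ n fun y => deriv u y + Complex.I * (k * t : ℝ) * u y :=
    (ContDiff.deriv' (by exact_mod_cast hu)).add
      (contDiff_const.mul (hu.of_le (by exact_mod_cast Nat.le_succ n)))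
  have hasDeriv {u : ℝ → ℂ} (hu : Differentiable ℝ u) (y : ℝ) :
      HasDerivAt u ((deriv u y + Complex.I * (k * t : ℝ) * u y)
        - Complex.I * (k * t : ℝ) * u y) y := by
    simpa using (hu y).hasDerivAt
  have cw1 := twisted (n := 2) cw
  have cw2 := twisted (n := 1) cw1
  have cw3 := twisted (n := 0) cw2
  have dw := cw.differentiable (by norm_num)
  have dw1 := cw1.differentiable (by norm_num)
  have dw2 := cw2.differentiable (by norm_num)
  rw [deriv_ew k t dw, deriv_ew k t dw1, deriv_ew k t dw2, L2sq_ew, L2sq_ew, L2sq_ew]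
  have hw_deriv := hasDeriv dw
  have hw1_deriv := hasDeriv dw1
  have hw2_deriv := hasDeriv dw2
  set w₁ : ℝ → ℂ := fun y => deriv w y + Complex.I * (k * t : ℝ) * w y
  set w₂ : ℝ → ℂ := fun y => deriv w₁ y + Complex.I * (k * t : ℝ) * w₁ y
  set w₃ : ℝ → ℂ := fun y => deriv w₂ y + Complex.I * (k * t : ℝ) * w₂ y
  set S := L2sq w₃ + k ^ 2 * L2sq w₂ + k ^ 4 * L2sq w₁ + k ^ 6 * L2sq w
  have p0 : 0 ≤ k ^ 6 * L2sq w := mul_nonneg (by positivity) (L2sq_nonneg _)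
  have p1 : 0 ≤ k ^ 4 * L2sq w₁ := mul_nonneg (by positivity) (L2sq_nonneg _)
  have p2 : 0 ≤ k ^ 2 * L2sq w₂ := mul_nonneg (by positivity) (L2sq_nonneg _)
  have p3 := L2sq_nonneg w₃
  have hM₁ : |k| ^ 2 * √(L2sq w₁) ≤ √S := by
    refine Real.le_sqrt_of_sq_le ?_
    rw [mul_pow, Real.sq_sqrt (L2sq_nonneg _), sq_abs, ← pow_mul, show 2 * 2 = 4 from rfl]
    linarith
  have hM₂ : |k| * √(L2sq w₂) ≤ √S := by
    refine Real.le_sqrt_of_sq_le ?_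
    rw [mul_pow, Real.sq_sqrt (L2sq_nonneg _), sq_abs]
    linarith
  have hM₃ : √(L2sq w₃) ≤ √S := Real.sqrt_le_sqrt (by linarith)
  have eq : ∀ y ∈ Icc (-1 : ℝ) 1, deriv (deriv ψ) y = (k : ℂ) ^ 2 * ψ y - w y := by
    have hcl : IsClosed {y : ℝ | deriv (deriv ψ) y = (k : ℂ) ^ 2 * ψ y - w y} :=
      isClosed_eq cψ2.continuous ((continuous_const.mul cψ.continuous).sub cw.continuous)
    have hsub : Ioo (-1 : ℝ) 1 ⊆ {y : ℝ | deriv (deriv ψ) y = (k : ℂ) ^ 2 * ψ y - w y} :=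
      fun y hy => by
        change deriv (deriv ψ) y = (k : ℂ) ^ 2 * ψ y - w y
        linear_combination ode y hy
    have := hcl.closure_subset_iff.2 hsub
    rwa [closure_Ioo (by norm_num)] at this
  have key := twisted_deriv_stream_le hk ht
    (fun y => (cψ.differentiable (by norm_num) y).hasDerivAt)
    (fun y => (cψ1.differentiable (by norm_num) y).hasDerivAt) cψ2.continuous
    hw_deriv hw1_deriv hw2_deriv cw3.continuous eq hψ₀ hψ₁ hw₀ hw1 hM₁ hM₂ hM₃
  simp only [Complex.ofReal_mul, ← mul_assoc] at key
  have hT : (1 + t ^ 2)⁻¹ ≤ 2 * ((1 + t) ^ 2)⁻¹ := by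
    rw [← div_eq_mul_inv, inv_eq_one_div, div_le_div_iff₀ (by positivity) (by positivity)]
    nlinarith [sq_nonneg (1 - t)]
  calc _ = |k| ^ 2 * (|k| ^ 2 *
        √(L2sq fun y => deriv ψ y + Complex.I * (k : ℂ) * (t : ℂ) * ψ y)) := by ring
    _ ≤ |k| ^ 2 * (24 * (k ^ 2 * (1 + t ^ 2))⁻¹ * √S) := by gcongr
    _ = 24 * (1 + t ^ 2)⁻¹ * √S := by
      rw [sq_abs]
      field_simp
    _ ≤ 24 * (2 * ((1 + t) ^ 2)⁻¹) * √S := by gcongr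
    _ = 48 * ((1 + t) ^ 2)⁻¹ * √S := by ring
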